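/- Fix an integer k ≥ 1, let τ(j) = 4k + 1 − j on {1, …, 4k}, and let M be a fixed-point-free involution of {1, …, 4k} with M ∘ τ = τ ∘ M and M({1, …, 2k}) = {1, …, 2k}. Let S be a finite set of pairs (i, j) with 1 ≤ i < j ≤ 4k and let h ⊆ {1, …, 4k}, subject to: distinct elements of S have distinct first coordinates and distinct second coordinates; the set I of first coordinates satisfies I ∩ M(I) = ∅, and the set T of second coordinates satisfies T ∩ M(T) = ∅; h is disjoint from I ∪ T; M(h) = h; |h| = 2k − 2|S|; (i, j) ∈ S if and only if (τ(j), τ(i)) ∈ S; and τ(h) = h. Let b be the number of matched pairs {p, M(p)} contained in {1, …, 2k} that either contain a point of I or are contained in h. Then the number of pairs (i, j) ∈ S with i ≤ 2k < j equals 2b − k. In particular, if k is even, this number is even. -/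

import Mathlib

/-- A fixed-point-free involution of a finite linearly ordered set `A` moves exactly half of
the points of `A` up. -/
theorem Finset.card_eq_two_mul_card_filter_lt_of_involution {α : Type*} [LinearOrder α]
    (A : Finset α) (f : α → α) (hmem : ∀ a ∈ A, f a ∈ A) (hinv : ∀ a ∈ A, f (f a) = a)
    (hne : ∀ a ∈ A, f a ≠ a) : A.card = 2 * (A.filter (fun a => a < f a)).card := by
  have heq : (A.filter (fun a => a < f a)).card = (A.filter (fun a => ¬ a < f a)).card := by
    refine Finset.card_bij' (fun a _ => f a) (fun a _ => f a) ?_ ?_ ?_ ?_ <;>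
      simp only [Finset.mem_filter] <;> rintro a ⟨ha, hlt⟩
    · exact ⟨hmem a ha, by rw [hinv a ha]; exact hlt.not_gt⟩
    · exact ⟨hmem a ha, by rw [hinv a ha]; exact lt_of_le_of_ne (not_lt.1 hlt) (hne a ha)⟩
    · exact hinv a ha
    · exact hinv a ha
  have := Finset.card_filter_add_card_filter_not (s := A) (fun a => a < f a)
  omega


/-- Counting identity for τ-symmetric strands diagrams over a real pointed matched circle
whose matching preserves the halves: with points `{1, …, 4k}`, reflection
`τ j = 4k + 1 − j`, and a fixed-point-free involution (matching) `M` of `{1, …, 4k}`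
commuting with `τ` and preserving `{1, …, 2k}`, let `S` be the set of moving strands
`(i, j)` (with `1 ≤ i < j ≤ 4k`, distinct initial points, distinct terminal points,
initial points disjoint from their `M`-images, terminal points disjoint from their
`M`-images) and `h ⊆ {1, …, 4k}` the `M`-invariant set of horizontal strands, disjoint
from all strand endpoints, with `|h| = 2k − 2|S|`, both preserved by `τ`.  Let `b` be
the number of matched pairs `{p, M p}` contained in `{1, …, 2k}` that either contain an
initial point of a strand or are contained in `h`.  Then the number of strands
`(i, j) ∈ S` with `i ≤ 2k < j` equals `2b − k`; in particular, if `k` is even this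
number is even. -/
theorem symmetric_strands_diagram_midpoint_count (k : ℕ) (hk : 1 ≤ k)
    (τ M : ℕ → ℕ)
    (hτ : ∀ j, τ j = 4 * k + 1 - j)
    (hMmem : ∀ j ∈ Finset.Icc 1 (4 * k), M j ∈ Finset.Icc 1 (4 * k))
    (hMinv : ∀ j ∈ Finset.Icc 1 (4 * k), M (M j) = j)
    (hMfpf : ∀ j ∈ Finset.Icc 1 (4 * k), M j ≠ j)
    (hMτ : ∀ j ∈ Finset.Icc 1 (4 * k), M (τ j) = τ (M j))
    (hMhalf : Finset.image M (Finset.Icc 1 (2 * k)) = Finset.Icc 1 (2 * k))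
    (S : Finset (ℕ × ℕ)) (h : Finset ℕ)
    (hS : ∀ p ∈ S, 1 ≤ p.1 ∧ p.1 < p.2 ∧ p.2 ≤ 4 * k)
    (hdistinct : ∀ p ∈ S, ∀ q ∈ S, p ≠ q → p.1 ≠ q.1 ∧ p.2 ≠ q.2)
    (hIM : ∀ p ∈ S, ∀ q ∈ S, M p.1 ≠ q.1)
    (hTM : ∀ p ∈ S, ∀ q ∈ S, M p.2 ≠ q.2)
    (hsub : h ⊆ Finset.Icc 1 (4 * k))
    (hdisj : ∀ x ∈ h, ∀ p ∈ S, x ≠ p.1 ∧ x ≠ p.2)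
    (hMh : Finset.image M h = h)
    (hcard : h.card + 2 * S.card = 2 * k)
    (hSτ : ∀ i j : ℕ, (i, j) ∈ S ↔ (τ j, τ i) ∈ S)
    (hhτ : Finset.image τ h = h) :
    (S.filter (fun q => q.1 ≤ 2 * k ∧ 2 * k < q.2)).card + k =
      2 * ((Finset.Icc 1 (2 * k)).filter (fun p => p < M p ∧ M p ≤ 2 * k ∧
          ((∃ q ∈ S, q.1 = p ∨ q.1 = M p) ∨ (p ∈ h ∧ M p ∈ h)))).card ∧
    (Even k → Even (S.filter (fun q => q.1 ≤ 2 * k ∧ 2 * k < q.2)).card) := by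
  have hML : ∀ p ∈ Finset.Icc 1 (2 * k), M p ∈ Finset.Icc 1 (2 * k) := fun p hp =>
    hMhalf ▸ Finset.mem_image_of_mem M hp
  have hL : ∀ p ∈ Finset.Icc 1 (2 * k), p ∈ Finset.Icc 1 (4 * k) := fun p hp => by
    simp only [Finset.mem_Icc] at hp ⊢; omega
  have hMinvL : ∀ p ∈ Finset.Icc 1 (2 * k), M (M p) = p := fun p hp => hMinv p (hL p hp)
  have hMh' : ∀ p ∈ h, M p ∈ h := fun p hp => hMh ▸ Finset.mem_image_of_mem M hp
  have hτh : ∀ p ∈ h, τ p ∈ h := fun p hp => hhτ ▸ Finset.mem_image_of_mem τ hp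
  set I := (S.filter (fun q => q.1 ≤ 2 * k)).image Prod.fst with hI
  set hl := h.filter (fun p => p ≤ 2 * k) with hhl
  have memI : ∀ p, p ∈ I ↔ (∃ q ∈ S, q.1 = p) ∧ p ≤ 2 * k := by
    intro p
    simp only [hI, Finset.mem_image, Finset.mem_filter]
    constructor
    · rintro ⟨q, ⟨hq, hle⟩, rfl⟩
      exact ⟨⟨q, hq, rfl⟩, hle⟩
    · rintro ⟨⟨q, hq, rfl⟩, hle⟩
      exact ⟨q, ⟨hq, hle⟩, rfl⟩
  have I_sub : ∀ p ∈ I, p ∈ Finset.Icc 1 (2 * k) := by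
    intro p hp
    obtain ⟨⟨q, hq, rfl⟩, hle⟩ := (memI p).1 hp
    exact Finset.mem_Icc.2 ⟨(hS q hq).1, hle⟩
  have hl_sub : ∀ p ∈ hl, p ∈ Finset.Icc 1 (2 * k) := by
    intro p hp
    obtain ⟨hp, hle⟩ := Finset.mem_filter.1 hp
    exact Finset.mem_Icc.2 ⟨(Finset.mem_Icc.1 (hsub hp)).1, hle⟩
  have cardI : I.card = (S.filter (fun q => q.1 ≤ 2 * k)).card := by
    refine Finset.card_image_of_injOn fun p hp q hq hpq => ?_
    by_contra hne
    exact (hdistinct p (Finset.mem_filter.1 hp).1 q (Finset.mem_filter.1 hq).1 hne).1 hpq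
  have cardMI : (I.image M).card = I.card := by
    refine Finset.card_image_of_injOn fun p hp q hq hpq => ?_
    rw [← hMinvL p (I_sub p hp), ← hMinvL q (I_sub q hq)]
    exact congrArg M hpq
  have mem_A : ∀ p, p ∈ (I ∪ I.image M) ∪ hl ↔ p ∈ Finset.Icc 1 (2 * k) ∧
      ((∃ q ∈ S, q.1 = p ∨ q.1 = M p) ∨ (p ∈ h ∧ M p ∈ h)) := by
    intro p
    simp only [Finset.mem_union, Finset.mem_image]
    constructor
    · rintro ((hp | ⟨r, hr, rfl⟩) | hp)
      · obtain ⟨⟨q, hq, hqp⟩, -⟩ := (memI p).1 hp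
        exact ⟨I_sub p hp, Or.inl ⟨q, hq, Or.inl hqp⟩⟩
      · obtain ⟨⟨q, hq, hqr⟩, -⟩ := (memI r).1 hr
        refine ⟨hML r (I_sub r hr), Or.inl ⟨q, hq, Or.inr ?_⟩⟩
        rw [hMinvL r (I_sub r hr), hqr]
      · have hph := (Finset.mem_filter.1 hp).1
        exact ⟨hl_sub p hp, Or.inr ⟨hph, hMh' p hph⟩⟩
    · rintro ⟨hp, ⟨q, hq, hqp | hqp⟩ | ⟨hph, -⟩⟩
      · exact Or.inl (Or.inl ((memI p).2 ⟨⟨q, hq, hqp⟩, (Finset.mem_Icc.1 hp).2⟩))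
      · exact Or.inl (Or.inr ⟨M p, (memI _).2 ⟨⟨q, hq, hqp⟩,
          (Finset.mem_Icc.1 (hML p hp)).2⟩, hMinvL p hp⟩)
      · exact Or.inr (Finset.mem_filter.2 ⟨hph, (Finset.mem_Icc.1 hp).2⟩)
  have cardA : ((I ∪ I.image M) ∪ hl).card = 2 * I.card + hl.card := by
    rw [Finset.card_union_of_disjoint, Finset.card_union_of_disjoint, cardMI, two_mul]
    · refine Finset.disjoint_left.2 fun p hp hp' => ?_
      obtain ⟨r, hr, rfl⟩ := Finset.mem_image.1 hp'
      obtain ⟨⟨q, hq, hqp⟩, -⟩ := (memI _).1 hp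
      obtain ⟨⟨q', hq', rfl⟩, -⟩ := (memI r).1 hr
      exact hIM q' hq' q hq hqp.symm
    · refine Finset.disjoint_left.2 fun p hp hp' => ?_
      have hph := (Finset.mem_filter.1 hp').1
      rcases Finset.mem_union.1 hp with hp | hp
      · obtain ⟨⟨q, hq, rfl⟩, -⟩ := (memI p).1 hp
        exact (hdisj _ hph q hq).1 rfl
      · obtain ⟨r, hr, rfl⟩ := Finset.mem_image.1 hp
        have hrh := hMh' _ hph
        rw [hMinvL r (I_sub r hr)] at hrh
        obtain ⟨⟨q, hq, rfl⟩, -⟩ := (memI r).1 hr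
        exact (hdisj _ hrh q hq).1 rfl
  have two_b := Finset.card_eq_two_mul_card_filter_lt_of_involution ((I ∪ I.image M) ∪ hl) M
    (by
      intro p hp
      rw [mem_A] at hp ⊢
      obtain ⟨hp, hc⟩ := hp
      refine ⟨hML p hp, ?_⟩
      rw [hMinvL p hp]
      exact hc.imp (fun ⟨q, hq, hqp⟩ => ⟨q, hq, hqp.symm⟩) And.symm)
    (fun p hp => hMinvL p ((mem_A p).1 hp).1)
    (fun p hp => hMfpf p (hL p ((mem_A p).1 hp).1))
  have hb : ((I ∪ I.image M) ∪ hl).filter (fun p => p < M p) =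
      (Finset.Icc 1 (2 * k)).filter (fun p => p < M p ∧ M p ≤ 2 * k ∧
        ((∃ q ∈ S, q.1 = p ∨ q.1 = M p) ∨ (p ∈ h ∧ M p ∈ h))) := by
    ext p
    rw [Finset.mem_filter, mem_A, Finset.mem_filter]
    constructor
    · rintro ⟨⟨hp, hc⟩, hlt⟩
      exact ⟨hp, hlt, (Finset.mem_Icc.1 (hML p hp)).2, hc⟩
    · rintro ⟨hp, hlt, -, hc⟩
      exact ⟨⟨hp, hc⟩, hlt⟩
  have h_half : hl.card = (h.filter (fun p => ¬ p ≤ 2 * k)).card := by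
    refine Finset.card_bij' (fun p _ => τ p) (fun p _ => τ p) ?_ ?_ ?_ ?_ <;>
      simp only [hhl, Finset.mem_filter] <;> rintro p ⟨hp, hle⟩ <;>
      have hp4 := Finset.mem_Icc.1 (hsub hp)
    · exact ⟨hτh p hp, by rw [hτ]; omega⟩
    · exact ⟨hτh p hp, by rw [hτ]; omega⟩
    · rw [hτ, hτ]; omega
    · rw [hτ, hτ]; omega
  have h_split := Finset.card_filter_add_card_filter_not (s := h) (fun p => p ≤ 2 * k)
  rw [← hhl, ← h_half] at h_split
  have S_reflect : (S.filter (fun q => ¬ q.1 ≤ 2 * k)).card =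
      (S.filter (fun q => q.2 ≤ 2 * k)).card := by
    refine Finset.card_bij' (fun q _ => (τ q.2, τ q.1)) (fun q _ => (τ q.2, τ q.1))
      ?_ ?_ ?_ ?_ <;>
      simp only [Finset.mem_filter] <;> rintro ⟨i, j⟩ ⟨hq, hle⟩ <;>
      have hij := hS _ hq <;> simp only at hle hij
    · exact ⟨(hSτ i j).1 hq, by simp only [hτ]; omega⟩
    · exact ⟨(hSτ i j).1 hq, by simp only [hτ]; omega⟩
    · simp only [hτ, Prod.mk.injEq]; omega
    · simp only [hτ, Prod.mk.injEq]; omega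
  have S_split := Finset.card_filter_add_card_filter_not (s := S) (fun q => q.1 ≤ 2 * k)
  have S_left : (S.filter (fun q => q.1 ≤ 2 * k)).card =
      (S.filter (fun q => q.2 ≤ 2 * k)).card +
        (S.filter (fun q => q.1 ≤ 2 * k ∧ 2 * k < q.2)).card := by
    rw [← Finset.card_union_of_disjoint]
    · congr 1
      ext q
      simp only [Finset.mem_filter, Finset.mem_union]
      constructor
      · rintro ⟨hq, hle⟩
        rcases le_or_gt q.2 (2 * k) with h2 | h2
        · exact Or.inl ⟨hq, h2⟩
        · exact Or.inr ⟨hq, hle, h2⟩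
      · rintro (⟨hq, hle⟩ | ⟨hq, hle, -⟩)
        · exact ⟨hq, (hS q hq).2.1.le.trans hle⟩
        · exact ⟨hq, hle⟩
    · refine Finset.disjoint_left.2 fun q hq hq' => ?_
      exact (Finset.mem_filter.1 hq).2.not_gt (Finset.mem_filter.1 hq').2.2
  rw [hb] at two_b
  have key : (S.filter (fun q => q.1 ≤ 2 * k ∧ 2 * k < q.2)).card + k =
      2 * ((Finset.Icc 1 (2 * k)).filter (fun p => p < M p ∧ M p ≤ 2 * k ∧
          ((∃ q ∈ S, q.1 = p ∨ q.1 = M p) ∨ (p ∈ h ∧ M p ∈ h)))).card := by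
    omega
  refine ⟨key, fun hke => ?_⟩
  rw [Nat.even_iff] at hke ⊢
  omega
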